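/- arXiv:2605.22045 — 6 statements merged into one kernel-verified Lean document; each statement's English description precedes it below -/
import Mathlib

section
/- Let C ⊆ ℝⁿ be a nonempty closed convex set, let L := aff(C − x₀) for some x₀ ∈ C (a linear subspace independent of the choice of x₀), let x* ∈ C, and let v ∈ ri(D_C(x*)) ∩ L, where ri(D_C(x*)) denotes the interior of the cone of feasible directions D_C(x*) relative to its affine hull. Then there exist ρ > 0, ε̄ > 0, and δ > 0 such that: (i) B(v, ρ) ∩ L ⊆ ri(D_C(x*)); and (ii) for every x ∈ C with ‖x − x*‖ < δ, every w ∈ B(v, ρ) ∩ L, and every t ∈ [0, ε̄], the point x + t·w belongs to C (i.e., the maximal feasible step length τ(x; w) := sup{t ≥ 0 : x + t·w ∈ C} satisfies τ(x; w) ≥ ε̄). -/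
open Filter Topology Set Metric

/-- The cone of feasible directions of `C` at `x̄`: `{w | ∃ λ > 0, x̄ + λ•w ∈ C}`. -/
def feasCone {n : ℕ} (C : Set (EuclideanSpace ℝ (Fin n)))
    (xbar : EuclideanSpace ℝ (Fin n)) : Set (EuclideanSpace ℝ (Fin n)) :=
  {w | ∃ lam : ℝ, 0 < lam ∧ xbar + lam • w ∈ C}

lemma ufr_mem_ri {n : ℕ} (S : Set (EuclideanSpace ℝ (Fin n))) (x : EuclideanSpace ℝ (Fin n)) :
    x ∈ intrinsicInterior ℝ S ↔ x ∈ affineSpan ℝ S ∧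
      ∃ r > (0 : ℝ), ∀ y ∈ affineSpan ℝ S, dist y x < r → y ∈ S := by
  rw [mem_intrinsicInterior]
  constructor
  · rintro ⟨y, hy, rfl⟩
    refine ⟨y.2, ?_⟩
    rw [mem_interior_iff_mem_nhds, Metric.mem_nhds_iff] at hy
    obtain ⟨r, hr, h⟩ := hy
    exact ⟨r, hr, fun z hz hd => h (a := ⟨z, hz⟩) (by simpa [Subtype.dist_eq] using hd)⟩
  · rintro ⟨hx, r, hr, h⟩
    refine ⟨⟨x, hx⟩, ?_, rfl⟩
    rw [mem_interior_iff_mem_nhds, Metric.mem_nhds_iff]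
    exact ⟨r, hr, fun z hz => h z z.2 (by simpa [Subtype.dist_eq] using hz)⟩

lemma ufr_span {n : ℕ} (C S : Set (EuclideanSpace ℝ (Fin n))) (p : EuclideanSpace ℝ (Fin n))
    (hp : p ∈ C) (h1 : (fun y => y - p) '' C ⊆ S) (h2 : S ⊆ vectorSpan ℝ C)
    (z : EuclideanSpace ℝ (Fin n)) : z ∈ affineSpan ℝ S ↔ z ∈ vectorSpan ℝ C := by
  have h0 : (0 : EuclideanSpace ℝ (Fin n)) ∈ S := h1 ⟨p, hp, by simp⟩
  have e : Submodule.span ℝ S = vectorSpan ℝ C := by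
    apply le_antisymm
    · exact Submodule.span_le.2 h2
    · rw [vectorSpan_eq_span_vsub_set_right ℝ hp]
      exact Submodule.span_mono h1
  have h3 := affineSpan_insert_zero (k := ℝ) S
  rw [Set.insert_eq_of_mem h0, e] at h3
  exact Set.ext_iff.1 h3 z

/-- uniform feasibility radius: for `v` in the relative interior of the cone
of feasible directions intersected with the direction subspace `L = aff(C - x₀)`, there are
`ρ, ε̄, δ > 0` such that (i) `B(v, ρ) ∩ L ⊆ ri(D_C(x*))` and (ii) every `x ∈ C` with
`‖x - x*‖ < δ` admits feasible steps of length up to `ε̄` along every `w ∈ B(v, ρ) ∩ L`. -/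
theorem uniform_feasibility_radius {n : ℕ}
    (C : Set (EuclideanSpace ℝ (Fin n)))
    (hC_ne : C.Nonempty) (hC_closed : IsClosed C) (hC_conv : Convex ℝ C)
    (x₀ : EuclideanSpace ℝ (Fin n)) (hx₀ : x₀ ∈ C)
    (L : Set (EuclideanSpace ℝ (Fin n)))
    (hL : L = (affineSpan ℝ ((fun y => y - x₀) '' C) : Set (EuclideanSpace ℝ (Fin n))))
    (xstar : EuclideanSpace ℝ (Fin n)) (hxstar : xstar ∈ C)
    (v : EuclideanSpace ℝ (Fin n))
    (hv : v ∈ intrinsicInterior ℝ (feasCone C xstar) ∩ L) :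
    ∃ ρ > (0 : ℝ), ∃ εbar > (0 : ℝ), ∃ δ > (0 : ℝ),
      (ball v ρ ∩ L ⊆ intrinsicInterior ℝ (feasCone C xstar)) ∧
      (∀ x ∈ C, ‖x - xstar‖ < δ → ∀ w ∈ ball v ρ ∩ L, ∀ t ∈ Icc (0 : ℝ) εbar,
        x + t • w ∈ C) := by
  obtain ⟨hv1, hvL⟩ := hv
  set M := vectorSpan ℝ C with hM
  have hsub : ∀ a ∈ C, ∀ b ∈ C, a - b ∈ M := fun a ha b hb => vsub_mem_vectorSpan ℝ ha hb
  have hLM : ∀ z, z ∈ L ↔ z ∈ M := by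
    intro z
    rw [hL]
    refine ufr_span C _ x₀ hx₀ subset_rfl ?_ z
    rintro _ ⟨y, hy, rfl⟩
    exact hsub y hy x₀ hx₀
  have hDM : ∀ z, z ∈ affineSpan ℝ (feasCone C xstar) ↔ z ∈ M := by
    refine ufr_span C _ xstar hxstar ?_ ?_
    · rintro _ ⟨y, hy, rfl⟩
      exact ⟨1, one_pos, by simpa using hy⟩
    · rintro w ⟨l, hl, hw⟩
      have h := M.smul_mem l⁻¹ (hsub _ hw _ hxstar)
      rwa [add_sub_cancel_left, inv_smul_smul₀ hl.ne'] at h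
  have hvM : v ∈ M := (hLM v).1 hvL
  obtain ⟨-, r, hr, hball⟩ := (ufr_mem_ri _ _).1 hv1
  obtain ⟨y0, hy0⟩ := hC_ne.intrinsicInterior hC_conv
  have hy0C : y0 ∈ C := intrinsicInterior_subset hy0
  obtain ⟨hy0a, r', hr', hball'⟩ := (ufr_mem_ri _ _).1 hy0
  have hseg : ∀ u, ∀ l : ℝ, 0 < l → xstar + l • u ∈ C → ∀ t : ℝ, 0 ≤ t → t ≤ l →
      ∀ x ∈ C, x + l • u ∈ C → x + t • u ∈ C := by
    intro u l hl _ t ht htl x hx hxu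
    have h := hC_conv hx hxu (a := 1 - t / l) (b := t / l)
      (by rw [sub_nonneg, div_le_one hl]; exact htl) (by positivity) (by ring)
    convert h using 1
    have : t = t / l * l := by field_simp
    rw [smul_add, smul_smul, ← this]
    module
  -- the point w0 and the extrapolated direction
  obtain ⟨w0, hw0⟩ : ∃ w0, w0 = y0 - xstar := ⟨_, rfl⟩
  have hw0M : w0 ∈ M := hw0 ▸ hsub _ hy0C _ hxstar
  obtain ⟨s, hs, hsr⟩ : ∃ s : ℝ, 0 < s ∧ s * ‖v - w0‖ < r := by
    refine ⟨r / (‖v - w0‖ + 1), by positivity, ?_⟩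
    rw [div_mul_eq_mul_div, div_lt_iff₀ (by positivity)]
    nlinarith
  obtain ⟨l1, hl1, hl1C⟩ : v + s • (v - w0) ∈ feasCone C xstar := by
    apply hball
    · rw [hDM]
      exact M.add_mem hvM (M.smul_mem _ (M.sub_mem hvM hw0M))
    · rw [dist_eq_norm, add_sub_cancel_left, norm_smul, Real.norm_of_nonneg hs.le]
      exact hsr
  obtain ⟨l, hl, hll1, hl1'⟩ : ∃ l : ℝ, 0 < l ∧ l ≤ l1 ∧ l ≤ 1 :=
    ⟨min l1 1, lt_min hl1 one_pos, min_le_left _ _, min_le_right _ _⟩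
  have hlC := hseg _ l1 hl1 hl1C l hl.le hll1 xstar hxstar hl1C
  -- a uniform ball
  obtain ⟨R, hR, hRC⟩ : ∃ R > (0 : ℝ), ∀ w ∈ M, ‖w - v‖ < R → xstar + l • w ∈ C := by
    refine ⟨s / (1 + s) * r', by positivity, fun w hw hwv => ?_⟩
    have h1 : xstar + (1 : ℝ) • (w0 + ((1 + s) / s) • (w - v)) ∈ C := by
      apply hball'
      · have e : xstar + (1 : ℝ) • (w0 + ((1 + s) / s) • (w - v))
            = (((1 + s) / s) • (w - v)) +ᵥ y0 := by
          rw [hw0, vadd_eq_add]; module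
        rw [e]
        apply AffineSubspace.vadd_mem_of_mem_direction _ hy0a
        rw [direction_affineSpan]
        exact M.smul_mem _ (M.sub_mem hw hvM)
      · have e : xstar + (1 : ℝ) • (w0 + ((1 + s) / s) • (w - v)) - y0
            = ((1 + s) / s) • (w - v) := by
          rw [hw0]; module
        rw [dist_eq_norm, e, norm_smul, Real.norm_of_nonneg (by positivity)]
        calc (1 + s) / s * ‖w - v‖ < (1 + s) / s * (s / (1 + s) * r') := by gcongr
          _ = r' := by field_simp
    have h2 := hseg _ 1 one_pos h1 l hl.le hl1' xstar hxstar h1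
    have h3 := hC_conv hlC h2 (a := 1 / (1 + s)) (b := s / (1 + s)) (by positivity)
      (by positivity) (by field_simp)
    convert h3 using 1
    match_scalars <;> field_simp <;> ring
  refine ⟨min (r / 2) (R / 2), by positivity, l, hl, l * (R / 2), by positivity, ?_, ?_⟩
  · rintro w ⟨hw, hwL⟩
    have hwr : dist w v < r / 2 := lt_of_lt_of_le hw (min_le_left _ _)
    rw [ufr_mem_ri]
    refine ⟨(hDM w).2 ((hLM w).1 hwL), r / 2, by positivity, fun y hy hyw => hball y hy ?_⟩
    linarith [dist_triangle y w v]
  · rintro x hx hxd w ⟨hw, hwL⟩ t ⟨ht0, htl⟩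
    have hwR : ‖w - v‖ < R / 2 := by
      rw [← dist_eq_norm]; exact lt_of_lt_of_le hw (min_le_right _ _)
    have hwM := (hLM w).1 hwL
    have hstar : xstar + l • w ∈ C := hRC w hwM (by linarith)
    refine hseg w l hl hstar t ht0 htl x hx ?_
    have h := hRC (w + l⁻¹ • (x - xstar))
      (M.add_mem hwM (M.smul_mem _ (hsub _ hx _ hxstar))) ?_
    · rw [smul_add, smul_inv_smul₀ hl.ne'] at h
      convert h using 1
      module
    · have e : w + l⁻¹ • (x - xstar) - v = (w - v) + l⁻¹ • (x - xstar) := by module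
      rw [e]
      have h5 : ‖l⁻¹ • (x - xstar)‖ < R / 2 := by
        rw [norm_smul, Real.norm_of_nonneg (by positivity), inv_mul_lt_iff₀ hl]
        exact hxd
      linarith [norm_add_le (w - v) (l⁻¹ • (x - xstar))]
end

section
/- Let h : ℝⁿ → ℝ, x* ∈ ℝⁿ, and suppose h is Lipschitz with constant L_h on the open ball B(x*, R_h) for some R_h > 0. Let v ∈ ℝⁿ with ‖v‖ = 1, suppose the directional derivative h'(x*; v) exists and equals −ε for some ε > 0, and let γ > 0 and r > 0. Then there exist t* ∈ (0, min{r, R_h/4}] and δ > 0 such that for every x ∈ ℝⁿ with ‖x − x*‖ < δ, every w ∈ ℝⁿ with ‖w‖ = 1 and ‖w − v‖ < δ, and every t ∈ [t*/2, t*], one has h(x + t·w) + (γ/2)·t² < h(x); in fact h(x + t·w) + (γ/2)·t² − h(x) ≤ −ε·t*/16. -/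
open Filter Topology Set Metric

/-- The one-sided directional derivative of `h` at `x` in direction `d` equals `D`. -/
def HasDirDeriv {n : ℕ} (h : EuclideanSpace ℝ (Fin n) → ℝ)
    (x d : EuclideanSpace ℝ (Fin n)) (D : ℝ) : Prop :=
  Tendsto (fun t : ℝ => (h (x + t • d) - h x) / t) (𝓝[>] (0 : ℝ)) (𝓝 D)

/-- uniform strict decrease: if `h` is `L_h`-Lipschitz on `B(x*, R_h)` and
`h'(x*; v) = -ε < 0` for a unit direction `v`, then there exist `t* ∈ (0, min{r, R_h/4}]`
and `δ > 0` such that, uniformly for `x` near `x*`, unit `w` near `v`, and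
`t ∈ [t*/2, t*]`, one has `h(x + t w) + (γ/2)t² < h(x)`, in fact with margin `-ε t*/16`. -/
theorem uniform_strict_decrease {n : ℕ}
    (h : EuclideanSpace ℝ (Fin n) → ℝ)
    (xstar : EuclideanSpace ℝ (Fin n))
    (Lh Rh : ℝ) (hRh : 0 < Rh)
    (hLip : ∀ y ∈ ball xstar Rh, ∀ z ∈ ball xstar Rh, |h y - h z| ≤ Lh * ‖y - z‖)
    (v : EuclideanSpace ℝ (Fin n)) (hv : ‖v‖ = 1)
    (ε : ℝ) (hε : 0 < ε)
    (hdir : HasDirDeriv h xstar v (-ε))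
    (γ r : ℝ) (hγ : 0 < γ) (hr : 0 < r) :
    ∃ tstar ∈ Set.Ioc (0 : ℝ) (min r (Rh / 4)), ∃ δ > (0 : ℝ),
      ∀ x : EuclideanSpace ℝ (Fin n), ‖x - xstar‖ < δ →
      ∀ w : EuclideanSpace ℝ (Fin n), ‖w‖ = 1 → ‖w - v‖ < δ →
      ∀ t ∈ Set.Icc (tstar / 2) tstar,
        h (x + t • w) + γ / 2 * t ^ 2 < h x ∧
        h (x + t • w) + γ / 2 * t ^ 2 - h x ≤ -ε * tstar / 16 := by
  have hev : ∀ᶠ t in 𝓝[>] (0:ℝ), (h (xstar + t • v) - h xstar) / t < -(3 * ε / 4) :=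
    Filter.Tendsto.eventually_lt_const (by linarith) hdir
  obtain ⟨s, hs, hsub⟩ := mem_nhdsGT_iff_exists_Ioo_subset.1 hev
  have hs0 : 0 < s := hs
  obtain ⟨T, hT0, hTs, hTr, hTR, hTe⟩ : ∃ T : ℝ, 0 < T ∧ T ≤ s / 2 ∧ T ≤ r ∧ T ≤ Rh / 4 ∧
      T ≤ ε / (4 * γ) := by
    refine ⟨min (min (s/2) r) (min (Rh/4) (ε / (4 * γ))), ?_, ?_, ?_, ?_, ?_⟩
    · have : 0 < ε / (4 * γ) := by positivity
      simp only [lt_min_iff]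
      refine ⟨⟨by linarith, hr⟩, by linarith, this⟩
    · exact (min_le_left _ _).trans (min_le_left _ _)
    · exact (min_le_left _ _).trans (min_le_right _ _)
    · exact (min_le_right _ _).trans (min_le_left _ _)
    · exact (min_le_right _ _).trans (min_le_right _ _)
  obtain ⟨M, hM0, hM⟩ : ∃ M : ℝ, 0 < M ∧ Lh ≤ M :=
    ⟨|Lh| + 1, by positivity, by linarith [le_abs_self Lh]⟩
  obtain ⟨δ, hδ0, hδR, hδ⟩ : ∃ δ : ℝ, 0 < δ ∧ δ ≤ Rh / 4 ∧ δ ≤ ε * T / (4 * (M * (2 + T))) :=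
    ⟨min (Rh / 4) (ε * T / (4 * (M * (2 + T)))), lt_min (by linarith) (by positivity),
      min_le_left _ _, min_le_right _ _⟩
  rw [le_div_iff₀ (by positivity)] at hδ hTe
  refine ⟨T, ⟨hT0, le_min hTr hTR⟩, δ, hδ0, ?_⟩
  intro x hx w hw hwv t ⟨ht1, ht2⟩
  have ht0 : 0 < t := by linarith
  have hmain : h (xstar + t • v) - h xstar < -(3 * ε / 4) * t := by
    have h1 : (h (xstar + t • v) - h xstar) / t < -(3 * ε / 4) :=
      hsub ⟨ht0, by linarith⟩
    exact (div_lt_iff₀ ht0).1 h1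
  have htw : ‖t • w‖ = t := by rw [norm_smul, hw, Real.norm_of_nonneg ht0.le, mul_one]
  have htv : ‖t • v‖ = t := by rw [norm_smul, hv, Real.norm_of_nonneg ht0.le, mul_one]
  have b1 : x + t • w ∈ ball xstar Rh := by
    rw [mem_ball_iff_norm, add_sub_right_comm]
    linarith [norm_add_le (x - xstar) (t • w)]
  have b2 : xstar + t • v ∈ ball xstar Rh := by
    rw [mem_ball_iff_norm, add_sub_cancel_left]
    linarith
  have b3 : x ∈ ball xstar Rh := by
    rw [mem_ball_iff_norm]; linarith
  have l1 := hLip _ b1 _ b2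
  have l2 := hLip _ b3 _ (mem_ball_self hRh)
  have n1 : ‖x + t • w - (xstar + t • v)‖ ≤ δ + T * δ := by
    have e : x + t • w - (xstar + t • v) = (x - xstar) + t • (w - v) := by
      rw [smul_sub]; abel
    have e2 : ‖t • (w - v)‖ ≤ T * δ := by
      rw [norm_smul, Real.norm_of_nonneg ht0.le]
      exact mul_le_mul ht2 hwv.le (norm_nonneg _) hT0.le
    rw [e]
    linarith [norm_add_le (x - xstar) (t • (w - v))]
  have l1' : |h (x + t • w) - h (xstar + t • v)| ≤ M * (δ + T * δ) :=
    l1.trans (mul_le_mul hM n1 (norm_nonneg _) hM0.le)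
  have l2' : |h x - h xstar| ≤ M * δ :=
    l2.trans (mul_le_mul hM hx.le (norm_nonneg _) hM0.le)
  have a1 := (abs_le.1 l1').2
  have a2 := (abs_le.1 l2').1
  have q : γ / 2 * t ^ 2 ≤ ε * t / 8 := by
    have : t * (4 * γ) ≤ ε := le_trans (by gcongr) hTe
    nlinarith
  have et : ε * (T / 2) ≤ ε * t := by gcongr
  have key : h (x + t • w) + γ / 2 * t ^ 2 - h x ≤ -ε * T / 16 := by
    linarith
  have : 0 < ε * T := by positivity
  exact ⟨by linarith, key⟩
end

section
/- Let C ⊆ ℝⁿ be a nonempty closed convex set, let f₁ : ℝⁿ → ℝ be μ₁-strongly convex and f₂ : ℝⁿ → ℝ be μ₂-strongly convex with μ₁ + μ₂ > 0, and set h := f₁ − f₂. Let x ∈ C, let g₂ be a subgradient of f₂ at x, and let z ∈ C be a minimizer over C of the function u ↦ f₁(u) − ⟨g₂, u⟩. Then h(x) − h(z) ≥ ((μ₁ + μ₂)/2)·‖x − z‖². -/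
open Set
open scoped RealInnerProductSpace

/-- `φ` is `μ`-strongly convex: `u ↦ φ(u) - (μ/2)‖u‖²` is convex. -/
def StronglyConvexOn' {n : ℕ} (μ : ℝ) (φ : EuclideanSpace ℝ (Fin n) → ℝ) : Prop :=
  ConvexOn ℝ univ (fun u => φ u - μ / 2 * ‖u‖ ^ 2)

theorem sc_aux {n : ℕ} (μ : ℝ) (hμ : 0 ≤ μ) (φ : EuclideanSpace ℝ (Fin n) → ℝ)
    (hφ : StronglyConvexOn' μ φ) (y u g : EuclideanSpace ℝ (Fin n))
    (h : ∀ t : ℝ, 0 < t → t < 1 → φ y + t * ⟪g, u - y⟫ ≤ φ ((1 - t) • y + t • u)) :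
    φ y + ⟪g, u - y⟫ + μ / 2 * ‖u - y‖ ^ 2 ≤ φ u := by
  have hs : StrongConvexOn univ μ φ := strongConvexOn_iff_convex.2 hφ
  have key : ∀ t : ℝ, 0 < t → t < 1 →
      (1 - t) * (μ / 2 * ‖u - y‖ ^ 2) ≤ φ u - φ y - ⟪g, u - y⟫ := by
    intro t h0 h1
    have h2 := hs.2 (mem_univ y) (mem_univ u) (sub_nonneg.2 h1.le) h0.le (by ring)
    have h3 := h t h0 h1
    simp only [smul_eq_mul] at h2
    rw [norm_sub_rev y u] at h2
    refine le_of_mul_le_mul_left ?_ h0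
    linarith
  have hK : 0 ≤ μ / 2 * ‖u - y‖ ^ 2 := by positivity
  generalize μ / 2 * ‖u - y‖ ^ 2 = K at *
  by_contra hlt
  have hD := key (1/2) (by norm_num) (by norm_num)
  have hKp : 0 < K := by linarith
  have h4 := key ((K - (φ u - φ y - ⟪g, u - y⟫)) / (2 * K))
    (div_pos (by linarith) (by linarith)) (by rw [div_lt_one (by linarith)]; linarith)
  rw [sub_mul, div_mul_eq_mul_div, mul_div_mul_right _ _ hKp.ne'] at h4
  linarith

/-- descent at the DCA oracle output: if `z` minimizes
`u ↦ f₁(u) - ⟨g₂, u⟩` over `C` for a subgradient `g₂ ∈ ∂f₂(x)`, then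
`h(x) - h(z) ≥ ((μ₁+μ₂)/2)‖x - z‖²` for `h = f₁ - f₂`. -/
theorem dca_descent {n : ℕ}
    (C : Set (EuclideanSpace ℝ (Fin n)))
    (hC_ne : C.Nonempty) (hC_closed : IsClosed C) (hC_conv : Convex ℝ C)
    (μ₁ μ₂ : ℝ) (hμ : 0 < μ₁ + μ₂) (hμ₁ : 0 ≤ μ₁) (hμ₂ : 0 ≤ μ₂)
    (f₁ f₂ : EuclideanSpace ℝ (Fin n) → ℝ)
    (hf₁ : StronglyConvexOn' μ₁ f₁) (hf₂ : StronglyConvexOn' μ₂ f₂)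
    (x : EuclideanSpace ℝ (Fin n)) (hx : x ∈ C)
    (g₂ : EuclideanSpace ℝ (Fin n))
    (hg₂ : ∀ u, f₂ u ≥ f₂ x + ⟪g₂, u - x⟫)
    (z : EuclideanSpace ℝ (Fin n)) (hz : z ∈ C)
    (hzmin : ∀ u ∈ C, f₁ z - ⟪g₂, z⟫ ≤ f₁ u - ⟪g₂, u⟫) :
    (f₁ x - f₂ x) - (f₁ z - f₂ z) ≥ (μ₁ + μ₂) / 2 * ‖x - z‖ ^ 2 := by
  have A := sc_aux μ₂ hμ₂ f₂ hf₂ x z g₂ (by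
    intro t _ _
    have h := hg₂ ((1 - t) • x + t • z)
    have e : (1 - t) • x + t • z - x = t • (z - x) := by module
    rw [e, real_inner_smul_right] at h
    exact h)
  have B := sc_aux μ₁ hμ₁ f₁ hf₁ z x g₂ (by
    intro t h0 h1
    have h := hzmin ((1 - t) • z + t • x)
      (hC_conv hz hx (sub_nonneg.2 h1.le) h0.le (by ring))
    have e : (1 - t) • z + t • x = z + t • (x - z) := by module
    rw [e, inner_add_right, real_inner_smul_right] at h
    rw [e]
    linarith)
  rw [norm_sub_rev z x, inner_sub_right] at A
  rw [inner_sub_right] at B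
  linarith
end

section
/- Let C ⊆ ℝⁿ be a nonempty closed convex set, let f₁ : ℝⁿ → ℝ be μ₁-strongly convex and f₂ : ℝⁿ → ℝ be μ₂-strongly convex with μ₁ + μ₂ > 0, set h := f₁ − f₂, and suppose h(x) ≥ h* for all x ∈ C. Let (xᵏ)_{k≥0} be a sequence in C and (zᵏ⁺¹)_{k≥0} a sequence such that for every k: there is a subgradient g₂ᵏ of f₂ at xᵏ with zᵏ⁺¹ ∈ C a minimizer over C of u ↦ f₁(u) − ⟨g₂ᵏ, u⟩, and h(xᵏ⁺¹) ≤ h(zᵏ⁺¹). Then for every N ≥ 1, min_{0 ≤ k ≤ N−1} ‖xᵏ − zᵏ⁺¹‖ ≤ √(2·(h(x⁰) − h*) / ((μ₁ + μ₂)·N)). -/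
open Set
open scoped RealInnerProductSpace

/-- Quadratic growth of a strongly convex function above a supporting direction. -/
lemma strong_growth {n : ℕ} {μ : ℝ} {φ : EuclideanSpace ℝ (Fin n) → ℝ}
    (hφ : StronglyConvexOn' μ φ) (y u g : EuclideanSpace ℝ (Fin n))
    (hg : ∀ t : ℝ, 0 < t → t < 1 → φ y + t * ⟪g, u - y⟫ ≤ φ ((1 - t) • y + t • u)) :
    φ y + ⟪g, u - y⟫ + μ / 2 * ‖u - y‖ ^ 2 ≤ φ u := by
  have key : ∀ t : ℝ, 0 < t → t < 1 →
      (1 - t) * (μ / 2 * ‖u - y‖ ^ 2) ≤ φ u - φ y - ⟪g, u - y⟫ := by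
    intro t h0 h1
    have hc := (strongConvexOn_iff_convex.2 hφ).2 (mem_univ y) (mem_univ u)
      (by linarith : (0 : ℝ) ≤ 1 - t) h0.le (by ring)
    have h2 := hg t h0 h1
    simp only [smul_eq_mul] at hc
    rw [norm_sub_rev y u] at hc
    have h3 : t * ((1 - t) * (μ / 2 * ‖u - y‖ ^ 2)) ≤ t * (φ u - φ y - ⟪g, u - y⟫) := by
      nlinarith
    exact le_of_mul_le_mul_left h3 h0
  have hlim : Filter.Tendsto (fun t : ℝ => (1 - t) * (μ / 2 * ‖u - y‖ ^ 2))
      (nhdsWithin 0 (Ioi 0)) (nhds ((1 - 0) * (μ / 2 * ‖u - y‖ ^ 2))) := by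
    have : Continuous (fun t : ℝ => (1 - t) * (μ / 2 * ‖u - y‖ ^ 2)) := by fun_prop
    exact (this.tendsto 0).mono_left nhdsWithin_le_nhds
  have hev := le_of_tendsto hlim (b := φ u - φ y - ⟪g, u - y⟫) (by
    filter_upwards [Ioo_mem_nhdsGT (zero_lt_one (α := ℝ))] with t ht
    exact key t ht.1 ht.2)
  linarith

/-- rate preservation under DCA: after `N` iterations of the
exploration-augmented DCA method,
`min_{0 ≤ k ≤ N-1} ‖xᵏ - zᵏ⁺¹‖ ≤ √(2(h(x⁰) - h*)/((μ₁+μ₂)N))`. -/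
theorem dca_rate {n : ℕ}
    (C : Set (EuclideanSpace ℝ (Fin n)))
    (hC_ne : C.Nonempty) (hC_closed : IsClosed C) (hC_conv : Convex ℝ C)
    (μ₁ μ₂ : ℝ) (hμ : 0 < μ₁ + μ₂) (hμ₁ : 0 ≤ μ₁) (hμ₂ : 0 ≤ μ₂)
    (f₁ f₂ : EuclideanSpace ℝ (Fin n) → ℝ)
    (hf₁ : StronglyConvexOn' μ₁ f₁) (hf₂ : StronglyConvexOn' μ₂ f₂)
    (hstar : ℝ)
    (hlow : ∀ x ∈ C, f₁ x - f₂ x ≥ hstar)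
    (x : ℕ → EuclideanSpace ℝ (Fin n)) (hx : ∀ k, x k ∈ C)
    (z : ℕ → EuclideanSpace ℝ (Fin n))  -- `z k` stands for `zᵏ⁺¹`
    (horacle : ∀ k, ∃ g₂ : EuclideanSpace ℝ (Fin n),
      (∀ u, f₂ u ≥ f₂ (x k) + ⟪g₂, u - x k⟫) ∧
      z k ∈ C ∧ (∀ u ∈ C, f₁ (z k) - ⟪g₂, z k⟫ ≤ f₁ u - ⟪g₂, u⟫))
    (hgreedy : ∀ k, f₁ (x (k + 1)) - f₂ (x (k + 1)) ≤ f₁ (z k) - f₂ (z k)) :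
    ∀ N : ℕ, 1 ≤ N → ∃ k < N,
      ‖x k - z k‖ ≤
        Real.sqrt (2 * ((f₁ (x 0) - f₂ (x 0)) - hstar) / ((μ₁ + μ₂) * N)) := by
  have step : ∀ k, (μ₁ + μ₂) / 2 * ‖x k - z k‖ ^ 2 ≤
      (f₁ (x k) - f₂ (x k)) - (f₁ (x (k + 1)) - f₂ (x (k + 1))) := by
    intro k
    obtain ⟨g, hg, hz, hmin⟩ := horacle k
    have h1 := strong_growth hf₁ (z k) (x k) g (by
      intro t h0 h1
      have := hmin _ (hC_conv hz (hx k) (by linarith : (0 : ℝ) ≤ 1 - t) h0.le (by ring))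
      simp only [inner_add_right, inner_sub_right, inner_smul_right] at this ⊢
      linarith)
    have h2 := strong_growth hf₂ (x k) (z k) g (by
      intro t h0 h1
      have := hg ((1 - t) • x k + t • z k)
      simp only [inner_add_right, inner_sub_right, inner_smul_right] at this ⊢
      linarith)
    have h3 := hgreedy k
    rw [norm_sub_rev (z k) (x k)] at h2
    simp only [inner_sub_right] at h1 h2
    linarith
  intro N hN
  by_contra! hcon
  have hNpos : (0 : ℝ) < N := by exact_mod_cast hN
  have hlt : ∀ k ∈ Finset.range N, (f₁ (x 0) - f₂ (x 0) - hstar) / N <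
      (f₁ (x k) - f₂ (x k)) - (f₁ (x (k + 1)) - f₂ (x (k + 1))) := by
    intro k hk
    have h1 := Real.lt_sq_of_sqrt_lt (hcon k (Finset.mem_range.1 hk))
    refine lt_of_lt_of_le ?_ (step k)
    calc (f₁ (x 0) - f₂ (x 0) - hstar) / N
        = (μ₁ + μ₂) / 2 * (2 * ((f₁ (x 0) - f₂ (x 0)) - hstar) / ((μ₁ + μ₂) * N)) := by
          field_simp
      _ < _ := mul_lt_mul_of_pos_left h1 (by linarith)
  have hsum := Finset.sum_lt_sum_of_nonempty (Finset.nonempty_range_iff.2 (by omega)) hlt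
  rw [Finset.sum_range_sub' (fun k => f₁ (x k) - f₂ (x k)), Finset.sum_const,
    Finset.card_range, nsmul_eq_mul, mul_div_cancel₀ _ hNpos.ne'] at hsum
  have := hlow (x N) (hx N)
  linarith
end

section
/- Let h : ℝⁿ → ℝ satisfy h(x) ≥ h* for all x ∈ ℝⁿ, and let α > 0. Let (xᵏ)_{k≥0} and (zᵏ⁺¹)_{k≥0} be sequences in ℝⁿ such that for every k: h(xᵏ) − h(zᵏ⁺¹) ≥ α·‖zᵏ⁺¹ − xᵏ‖² and h(xᵏ⁺¹) ≤ h(zᵏ⁺¹). Then for every N ≥ 1, min_{0 ≤ k ≤ N−1} ‖xᵏ − zᵏ⁺¹‖ ≤ √((h(x⁰) − h*)/(α·N)). -/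
open Set

/-- rate preservation for prox-linear-type oracles: quadratic decrease
plus greedy selection gives `min_{0 ≤ k ≤ N-1} ‖xᵏ - zᵏ⁺¹‖ ≤ √((h(x⁰) - h*)/(αN))`. -/
theorem proxlinear_rate {n : ℕ}
    (h : EuclideanSpace ℝ (Fin n) → ℝ)
    (hstar : ℝ) (hlow : ∀ x, h x ≥ hstar)
    (α : ℝ) (hα : 0 < α)
    (x z : ℕ → EuclideanSpace ℝ (Fin n))  -- `z k` stands for `zᵏ⁺¹`
    (hdec : ∀ k, h (x k) - h (z k) ≥ α * ‖z k - x k‖ ^ 2)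
    (hgreedy : ∀ k, h (x (k + 1)) ≤ h (z k)) :
    ∀ N : ℕ, 1 ≤ N → ∃ k < N,
      ‖x k - z k‖ ≤ Real.sqrt ((h (x 0) - hstar) / (α * N)) := by
  intro N hN
  by_contra! hcon
  set B : ℝ := (h (x 0) - hstar) / (α * N) with hB
  have hNpos : (0 : ℝ) < N := by exact_mod_cast hN
  have hBN : (N : ℝ) * (α * B) = h (x 0) - hstar := by
    rw [hB]
    field_simp
  have step : ∀ k < N, h (x (k + 1)) < h (x k) - α * B := by
    intro k hk
    have h1 : B < ‖x k - z k‖ ^ 2 := Real.lt_sq_of_sqrt_lt (hcon k hk)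
    rw [norm_sub_rev] at h1
    have h2 := mul_lt_mul_of_pos_left h1 hα
    linarith [hdec k, hgreedy k]
  have main : ∀ m, m < N → h (x (m + 1)) < h (x 0) - ((m + 1 : ℕ) : ℝ) * (α * B) := by
    intro m
    induction m with
    | zero =>
      intro hm
      simpa using step 0 hm
    | succ m ih =>
      intro hm
      have h1 := ih (by omega)
      have h2 := step (m + 1) hm
      push_cast at h1 ⊢
      linarith
  obtain ⟨m, rfl⟩ : ∃ m, N = m + 1 := ⟨N - 1, by omega⟩
  have h1 := main m (by omega)
  rw [hBN] at h1
  linarith [hlow (x (m + 1))]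
end

section
/- Let f, g : ℝᵐ → ℝ be convex, set c := f − g, and assume c is globally L_c-Lipschitz. Let F : ℝⁿ → ℝᵐ be continuously differentiable with derivative DF that is L_F-Lipschitz in operator norm, set h := c ∘ F, fix ρ > L_c·L_F, and assume the sublevel set {x ∈ ℝⁿ : h(x) ≤ h(x⁰)} is bounded. Let (xᵏ)_{k≥0} and (zᵏ⁺¹)_{k≥0} be sequences in ℝⁿ such that for every k, writing ℓᵏ(y) := F(xᵏ) + DF(xᵏ)(y − xᵏ): (a) there exist ξᵏ⁺¹ a subgradient of f at ℓᵏ(zᵏ⁺¹) and ηᵏ⁺¹ a subgradient of g at ℓᵏ(zᵏ⁺¹) with DF(xᵏ)ᵀξᵏ⁺¹ + ρ·(zᵏ⁺¹ − xᵏ) = DF(xᵏ)ᵀηᵏ⁺¹; (b) c(ℓᵏ(zᵏ⁺¹)) + (ρ/2)‖zᵏ⁺¹ − xᵏ‖² ≤ h(xᵏ); and (c) h(xᵏ⁺¹) ≤ min{h(zᵏ⁺¹), h(xᵏ)}. Then (xᵏ) has at least one accumulation point, and every accumulation point x* of (xᵏ) satisfies: there exist ξ* a subgradient of f at F(x*)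 and η* a subgradient of g at F(x*) with DF(x*)ᵀξ* = DF(x*)ᵀη*; i.e., ∇F(x*)ᵀ∂f(F(x*)) ∩ ∇F(x*)ᵀ∂g(F(x*)) ≠ ∅ (DC criticality of h = f∘F − g∘F at x*). -/
open Filter Topology Set
open scoped RealInnerProductSpace

lemma aux_clm {E G : Type*} [NormedAddCommGroup E] [NormedSpace ℝ E]
    [NormedAddCommGroup G] [NormedSpace ℝ G] {A : ℕ → (E →L[ℝ] G)} {v : ℕ → E}
    {A0 : E →L[ℝ] G} {v0 : E} (hA : Tendsto A atTop (𝓝 A0)) (hv : Tendsto v atTop (𝓝 v0)) :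
    Tendsto (fun q => A q (v q)) atTop (𝓝 (A0 v0)) :=
  ((isBoundedBilinearMap_apply (𝕜 := ℝ) (E := E) (F := G)).continuous.tendsto (A0, v0)).comp
    (hA.prodMk_nhds hv)

lemma aux_descent {E G : Type*} [NormedAddCommGroup E] [NormedSpace ℝ E]
    [NormedAddCommGroup G] [NormedSpace ℝ G] (F : E → G) (DF : E → (E →L[ℝ] G))
    (hF : ∀ y, HasFDerivAt F (DF y) y) (LF : ℝ)
    (hDFlip : ∀ y y', ‖DF y - DF y'‖ ≤ LF * ‖y - y'‖) (x z : E) :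
    ‖F z - (F x + DF x (z - x))‖ ≤ LF / 2 * ‖z - x‖ ^ 2 := by
  set d := z - x with hd
  have hder : ∀ t : ℝ, HasDerivAt (fun t : ℝ => F (x + t • d) - (F x + t • DF x d))
      (DF (x + t • d) d - DF x d) t := by
    intro t
    have h1 : HasDerivAt (fun t : ℝ => x + t • d) d t := by
      simpa using ((hasDerivAt_id t).smul_const d).const_add x
    have h2 : HasDerivAt (fun t : ℝ => F (x + t • d)) (DF (x + t • d) d) t :=
      (hF (x + t • d)).comp_hasDerivAt t h1
    have h3 : HasDerivAt (fun t : ℝ => F x + t • DF x d) (DF x d) t := by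
      simpa using ((hasDerivAt_id t).smul_const (DF x d)).const_add (F x)
    exact h2.sub h3
  have hB : ∀ t : ℝ, HasDerivAt (fun t : ℝ => LF / 2 * ‖d‖ ^ 2 * t ^ 2)
      (LF * t * ‖d‖ ^ 2) t := by
    intro t
    have := ((hasDerivAt_pow 2 t).const_mul (LF / 2 * ‖d‖ ^ 2))
    refine this.congr_deriv ?_
    simp only [Nat.cast_ofNat, Nat.add_one_sub_one, pow_one]
    ring
  have key := image_norm_le_of_norm_deriv_right_le_deriv_boundary (a := 0) (b := 1)
    (f := fun t : ℝ => F (x + t • d) - (F x + t • DF x d))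
    (f' := fun t => DF (x + t • d) d - DF x d)
    (fun t _ => (hder t).continuousAt.continuousWithinAt)
    (fun t _ => (hder t).hasDerivWithinAt)
    (B := fun t : ℝ => LF / 2 * ‖d‖ ^ 2 * t ^ 2) (B' := fun t => LF * t * ‖d‖ ^ 2)
    (by simp) hB
    (by
      intro t ht
      have h1 : ‖(DF (x + t • d) - DF x) d‖ ≤ ‖DF (x + t • d) - DF x‖ * ‖d‖ :=
        ContinuousLinearMap.le_opNorm _ _
      have h2 := hDFlip (x + t • d) x
      have h3 : ‖x + t • d - x‖ = t * ‖d‖ := by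
        rw [add_sub_cancel_left, norm_smul, Real.norm_of_nonneg ht.1]
      rw [h3] at h2
      calc ‖DF (x + t • d) d - DF x d‖ ≤ ‖DF (x + t • d) - DF x‖ * ‖d‖ := h1
        _ ≤ LF * (t * ‖d‖) * ‖d‖ := by gcongr
        _ = LF * t * ‖d‖ ^ 2 := by ring)
    (x := 1) (by simp)
  simpa [hd] using key

lemma aux_subgrad {m : ℕ} (f : EuclideanSpace ℝ (Fin m) → ℝ) (hf : Continuous f)
    (y ξ : ℕ → EuclideanSpace ℝ (Fin m)) (ys : EuclideanSpace ℝ (Fin m))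
    (hy : Tendsto y atTop (𝓝 ys))
    (hs : ∀ q u, f u ≥ f (y q) + ⟪ξ q, u - y q⟫) :
    ∃ ξs : EuclideanSpace ℝ (Fin m), ∃ φ : ℕ → ℕ, StrictMono φ ∧
      Tendsto (fun q => ξ (φ q)) atTop (𝓝 ξs) ∧ ∀ u, f u ≥ f ys + ⟪ξs, u - ys⟫ := by
  obtain ⟨R, hR⟩ := (Metric.isBounded_range_of_tendsto y hy).exists_norm_le
  obtain ⟨M, hM⟩ := (isCompact_closedBall (0 : EuclideanSpace ℝ (Fin m)) (R + 1)).exists_bound_of_continuousOn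
    hf.continuousOn
  have hbd : ∀ q, ξ q ∈ Metric.closedBall (0 : EuclideanSpace ℝ (Fin m)) (2 * M) := by
    intro q
    rw [mem_closedBall_zero_iff]
    have hyq : ‖y q‖ ≤ R := hR _ (mem_range_self q)
    have h1 := hM (y q) (by rw [mem_closedBall_zero_iff]; linarith)
    rw [Real.norm_eq_abs, abs_le] at h1
    by_cases h0 : ξ q = 0
    · rw [h0, norm_zero]; linarith [h1.1, h1.2]
    have hn : ‖ξ q‖ ≠ 0 := norm_ne_zero_iff.2 h0
    have hu : ‖‖ξ q‖⁻¹ • ξ q‖ = 1 := by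
      rw [norm_smul, norm_inv, norm_norm, inv_mul_cancel₀ hn]
    have h2 := hM (y q + ‖ξ q‖⁻¹ • ξ q) (by
      rw [mem_closedBall_zero_iff]
      exact (norm_add_le _ _).trans (by linarith))
    rw [Real.norm_eq_abs, abs_le] at h2
    have h3 := hs q (y q + ‖ξ q‖⁻¹ • ξ q)
    rw [add_sub_cancel_left, inner_smul_right, real_inner_self_eq_norm_sq] at h3
    have h4 : ‖ξ q‖⁻¹ * ‖ξ q‖ ^ 2 = ‖ξ q‖ := by field_simp
    rw [h4] at h3
    linarith [h1.1, h2.2]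
  obtain ⟨ξs, -, φ, hφ, hlim⟩ := tendsto_subseq_of_bounded Metric.isBounded_closedBall hbd
  refine ⟨ξs, φ, hφ, hlim, fun u => ?_⟩
  have hyφ := hy.comp hφ.tendsto_atTop
  have hL : Tendsto (fun q => f (y (φ q)) + ⟪ξ (φ q), u - y (φ q)⟫) atTop
      (𝓝 (f ys + ⟪ξs, u - ys⟫)) :=
    ((hf.tendsto ys).comp hyφ).add (Filter.Tendsto.inner hlim (tendsto_const_nhds.sub hyφ))
  exact le_of_tendsto' hL (fun q => hs (φ q) u)

/-- DC criticality at accumulation points of the prox-linear DC scheme. -/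
theorem dc_criticality_accumulation {n m : ℕ}
    (f g : EuclideanSpace ℝ (Fin m) → ℝ)
    (hf : ConvexOn ℝ univ f) (hg : ConvexOn ℝ univ g)
    (Lc : ℝ)
    (hclip : ∀ u v, |(f u - g u) - (f v - g v)| ≤ Lc * ‖u - v‖)
    (F : EuclideanSpace ℝ (Fin n) → EuclideanSpace ℝ (Fin m))
    (DF : EuclideanSpace ℝ (Fin n) →
      (EuclideanSpace ℝ (Fin n) →L[ℝ] EuclideanSpace ℝ (Fin m)))
    (hF : ∀ y, HasFDerivAt F (DF y) y)
    (hDFcont : Continuous DF)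
    (LF : ℝ) (hDFlip : ∀ y y', ‖DF y - DF y'‖ ≤ LF * ‖y - y'‖)
    (ρ : ℝ) (hρ : ρ > Lc * LF)
    (x z : ℕ → EuclideanSpace ℝ (Fin n))  -- `z k` stands for `zᵏ⁺¹`
    (hsublevel : Bornology.IsBounded
      {y : EuclideanSpace ℝ (Fin n) | f (F y) - g (F y) ≤ f (F (x 0)) - g (F (x 0))})
    -- (a) DC criticality of the local model at the oracle output
    (ha : ∀ k, ∃ ξ η : EuclideanSpace ℝ (Fin m),
      (∀ u, f u ≥ f (F (x k) + DF (x k) (z k - x k)) +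
        ⟪ξ, u - (F (x k) + DF (x k) (z k - x k))⟫) ∧
      (∀ u, g u ≥ g (F (x k) + DF (x k) (z k - x k)) +
        ⟪η, u - (F (x k) + DF (x k) (z k - x k))⟫) ∧
      ContinuousLinearMap.adjoint (DF (x k)) ξ + ρ • (z k - x k)
        = ContinuousLinearMap.adjoint (DF (x k)) η)
    -- (b) model decrease
    (hb : ∀ k, (f (F (x k) + DF (x k) (z k - x k)) - g (F (x k) + DF (x k) (z k - x k)))
        + ρ / 2 * ‖z k - x k‖ ^ 2 ≤ f (F (x k)) - g (F (x k)))
    -- (c) greedy selection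
    (hc : ∀ k, f (F (x (k + 1))) - g (F (x (k + 1)))
        ≤ min (f (F (z k)) - g (F (z k))) (f (F (x k)) - g (F (x k)))) :
    (∃ xstar : EuclideanSpace ℝ (Fin n), ∃ φ : ℕ → ℕ, StrictMono φ ∧
      Tendsto (fun q => x (φ q)) atTop (𝓝 xstar)) ∧
    (∀ xstar : EuclideanSpace ℝ (Fin n),
      (∃ φ : ℕ → ℕ, StrictMono φ ∧ Tendsto (fun q => x (φ q)) atTop (𝓝 xstar)) →
      ∃ ξ η : EuclideanSpace ℝ (Fin m),
        (∀ u, f u ≥ f (F xstar) + ⟪ξ, u - F xstar⟫) ∧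
        (∀ u, g u ≥ g (F xstar) + ⟪η, u - F xstar⟫) ∧
        ContinuousLinearMap.adjoint (DF xstar) ξ
          = ContinuousLinearMap.adjoint (DF xstar) η) := by
  have hFc : Continuous F := continuous_iff_continuousAt.2 fun y => (hF y).continuousAt
  have hfc : Continuous f := hf.locallyLipschitz.continuous
  have hgc : Continuous g := hg.locallyLipschitz.continuous
  have hanti : Antitone (fun k => f (F (x k)) - g (F (x k))) :=
    antitone_nat_of_succ_le fun k => (hc k).trans (min_le_right _ _)
  have hmem : ∀ k, x k ∈ {y : EuclideanSpace ℝ (Fin n) |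
      f (F y) - g (F y) ≤ f (F (x 0)) - g (F (x 0))} := fun k => hanti (Nat.zero_le k)
  refine ⟨?_, ?_⟩
  · obtain ⟨a, -, φ, hφ, h⟩ := tendsto_subseq_of_bounded hsublevel hmem
    exact ⟨a, φ, hφ, h⟩
  rintro xs ⟨φ, hφ, hx⟩
  rcases Nat.eq_zero_or_pos m with rfl | hm
  · refine ⟨0, 0, fun u => ?_, fun u => ?_, rfl⟩
    · rw [Subsingleton.elim u (F xs)]; simp
    · rw [Subsingleton.elim u (F xs)]; simp
  have hLc : 0 ≤ Lc := by
    have h := hclip (EuclideanSpace.single (⟨0, hm⟩ : Fin m) (1 : ℝ)) 0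
    have h1 := (abs_nonneg _).trans h
    simpa using h1
  have hdec : ∀ k, (ρ - Lc * LF) / 2 * ‖z k - x k‖ ^ 2 ≤
      (f (F (x k)) - g (F (x k))) - (f (F (x (k + 1))) - g (F (x (k + 1)))) := by
    intro k
    have h1 := aux_descent F DF hF LF hDFlip (x k) (z k)
    have h2 := (le_abs_self _).trans (hclip (F (z k)) (F (x k) + DF (x k) (z k - x k)))
    have h3 := mul_le_mul_of_nonneg_left h1 hLc
    have h4 := hb k
    have h5 := (hc k).trans (min_le_left _ _)
    linarith
  have hbelow : BddBelow (range fun k => f (F (x k)) - g (F (x k))) := by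
    obtain ⟨M, hM⟩ := hsublevel.isCompact_closure.exists_bound_of_continuousOn
      (f := fun y => f (F y) - g (F y))
      ((hfc.comp hFc).sub (hgc.comp hFc)).continuousOn
    refine ⟨-M, ?_⟩
    rintro _ ⟨k, rfl⟩
    have := hM (x k) (subset_closure (hmem k))
    rw [Real.norm_eq_abs] at this
    exact (abs_le.1 this).1
  have hconv := tendsto_atTop_ciInf hanti hbelow
  have hdiff := hconv.sub (hconv.comp (tendsto_add_atTop_nat 1))
  rw [sub_self] at hdiff
  have hpos : 0 < (ρ - Lc * LF) / 2 := by linarith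
  have hsq : Tendsto (fun k => (ρ - Lc * LF) / 2 * ‖z k - x k‖ ^ 2) atTop (𝓝 0) :=
    squeeze_zero (fun k => by positivity) hdec hdiff
  have hsq2 : Tendsto (fun k => ‖z k - x k‖ ^ 2) atTop (𝓝 0) := by
    have := hsq.const_mul ((ρ - Lc * LF) / 2)⁻¹
    simpa only [inv_mul_cancel_left₀ hpos.ne', mul_zero] using this
  have hd : Tendsto (fun k => z k - x k) atTop (𝓝 0) := by
    rw [tendsto_zero_iff_norm_tendsto_zero]
    have := hsq2.sqrt
    simpa using this
  choose ξ η hξ hη heq using ha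
  have hdφ := hd.comp hφ.tendsto_atTop
  have hDφ : Tendsto (fun q => DF (x (φ q))) atTop (𝓝 (DF xs)) := (hDFcont.tendsto xs).comp hx
  have hy : Tendsto (fun q => F (x (φ q)) + DF (x (φ q)) (z (φ q) - x (φ q))) atTop
      (𝓝 (F xs)) := by
    have := ((hFc.tendsto xs).comp hx).add (aux_clm hDφ hdφ)
    simpa using this
  obtain ⟨ξs, ψ, hψ, hξl, hξs⟩ := aux_subgrad f hfc _ (fun q => ξ (φ q)) _ hy
    (fun q u => hξ (φ q) u)
  obtain ⟨ηs, χ, hχ, hηl, hηs⟩ := aux_subgrad g hgc _ (fun q => η (φ (ψ q))) _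
    (hy.comp hψ.tendsto_atTop) (fun q u => hη (φ (ψ q)) u)
  refine ⟨ξs, ηs, hξs, hηs, ?_⟩
  have hτ : Tendsto (fun q => ψ (χ q)) atTop atTop := hψ.tendsto_atTop.comp hχ.tendsto_atTop
  have hA : Tendsto (fun q => ContinuousLinearMap.adjoint (DF (x (φ (ψ (χ q)))))) atTop
      (𝓝 (ContinuousLinearMap.adjoint (DF xs))) :=
    ((ContinuousLinearMap.adjoint (𝕜 := ℝ) (E := EuclideanSpace ℝ (Fin n))
      (F := EuclideanSpace ℝ (Fin m))).continuous.tendsto (DF xs)).comp (hDφ.comp hτ)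
  have hl := (aux_clm hA (hξl.comp hχ.tendsto_atTop)).add ((hdφ.comp hτ).const_smul ρ)
  have hr := aux_clm hA hηl
  rw [smul_zero, add_zero] at hl
  refine tendsto_nhds_unique hl (hr.congr fun q => ?_)
  exact (heq _).symm
end
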